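/- There exists an absolute constant C > 0 such that the following holds. Let n, m ≥ 2, let s ≥ 2, let x₁, …, x_m ∈ ℂ^n with ‖x_i‖_∞ ≤ M for all i, and define the seminorm ‖x‖_X = max_{1 ≤ i ≤ m} |⟨x, x_i⟩| on ℂ^n. Let T' ⊆ ℂ^n be the union, over all index sets Γ ⊆ {1,…,n} with |Γ| ≤ s, of the sets of vectors supported on Γ with ℓ₂ norm equal to 1. Then ∫₀^∞ √( log N(T', ‖·‖_X, t) ) dt ≤ C · M · √s · log s · (log m)^{1/2} · (log n)^{1/2}, where N(T', ‖·‖_X, t) denotes the minimal number of ‖·‖_X-balls of radius t needed to cover T'. -/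

import Mathlib

/-- The covering number of a set `T` under the distance `d` at scale `t`:
the smallest cardinality of a finite set of points whose closed `d`-balls of
radius `t` cover `T` (`⊤` if no finite cover exists). -/
noncomputable def coveringNumber {E : Type*} (T : Set E) (d : E → E → ℝ) (t : ℝ) : ℕ∞ :=
  sInf ((fun S : Finset E => (S.card : ℕ∞)) ''
    {S : Finset E | ∀ x ∈ T, ∃ c ∈ S, d x c ≤ t})

lemma cov_log_le {E ι : Type*} [Fintype ι] (T : Set E) (d : E → E → ℝ) (t : ℝ) (c : ι → E)
    (h : ∀ x ∈ T, ∃ i, d x (c i) ≤ t) :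
    Real.log ((coveringNumber T d t).toNat : ℝ) ≤ Real.log (Fintype.card ι : ℝ) := by
  classical
  have h1 : coveringNumber T d t ≤ ((Finset.univ.image c).card : ℕ∞) := by
    apply sInf_le
    refine ⟨Finset.univ.image c, ?_, rfl⟩
    intro x hx
    obtain ⟨i, hi⟩ := h x hx
    exact ⟨c i, Finset.mem_image_of_mem _ (Finset.mem_univ _), hi⟩
  have h2 : (coveringNumber T d t).toNat ≤ Fintype.card ι := by
    calc (coveringNumber T d t).toNat ≤ ((Finset.univ.image c).card : ℕ∞).toNat :=
          ENat.toNat_le_toNat h1 (ENat.natCast_ne_top _)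
      _ = (Finset.univ.image c).card := ENat.toNat_natCast _
      _ ≤ Fintype.card ι := Finset.card_image_le
  rcases Nat.eq_zero_or_pos (coveringNumber T d t).toNat with h0 | h0
  · rw [h0]; simp only [Nat.cast_zero, Real.log_zero]; exact Real.log_natCast_nonneg _
  · exact Real.log_le_log (by exact_mod_cast h0) (by exact_mod_cast h2)

lemma greedy {V J : Type*} [Fintype V] [Fintype J] (q : V → ℝ) (hq : ∀ v, 0 ≤ q v)
    (hq1 : ∑ v, q v = 1) (u : V → J → ℝ) (hu : ∀ v j, |u v j| ≤ 1)
    (hmean : ∀ j, ∑ v, q v * u v j = 0) (l : ℝ) (hl0 : 0 ≤ l) (hl1 : l ≤ 1) (L : ℕ) :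
    ∃ w : Fin L → V, ∑ j, Real.exp (l * ∑ k, u (w k) j) ≤ Fintype.card J * Real.exp (l ^ 2 * L) := by
  induction L with
  | zero => exact ⟨Fin.elim0, by simp⟩
  | succ L ih =>
    obtain ⟨w, hw⟩ := ih
    set Φ : ℝ := ∑ j, Real.exp (l * ∑ k, u (w k) j) with hΦ
    have hexp : ∀ v j, Real.exp (l * u v j) ≤ 1 + l * u v j + l ^ 2 := by
      intro v j
      have h1 : |l * u v j| ≤ l := by
        rw [abs_mul, abs_of_nonneg hl0]
        exact mul_le_of_le_one_right hl0 (hu v j)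
      have h2 := Real.abs_exp_sub_one_sub_id_le (h1.trans hl1)
      have h3 := (abs_le.1 h2).2
      have h4 : (l * u v j) ^ 2 ≤ l ^ 2 := by
        rw [← sq_abs]; exact pow_le_pow_left₀ (abs_nonneg _) h1 2
      linarith
    have havg : ∑ v, q v * (∑ j, Real.exp (l * ∑ k, u (w k) j) * Real.exp (l * u v j))
        ≤ ∑ v, q v * ((1 + l ^ 2) * Φ) := by
      have e1 : ∑ v, q v * (∑ j, Real.exp (l * ∑ k, u (w k) j) * Real.exp (l * u v j))
          ≤ ∑ v, q v * (∑ j, Real.exp (l * ∑ k, u (w k) j) * (1 + l * u v j + l ^ 2)) := by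
        refine Finset.sum_le_sum fun v _ => mul_le_mul_of_nonneg_left ?_ (hq v)
        exact Finset.sum_le_sum fun j _ => mul_le_mul_of_nonneg_left (hexp v j) (Real.exp_pos _).le
      refine e1.trans (le_of_eq ?_)
      rw [← Finset.sum_mul, hq1, one_mul]
      have : ∀ v, q v * (∑ j, Real.exp (l * ∑ k, u (w k) j) * (1 + l * u v j + l ^ 2))
          = ∑ j, Real.exp (l * ∑ k, u (w k) j) * ((1 + l ^ 2) * q v + l * (q v * u v j)) := by
        intro v; rw [Finset.mul_sum]; exact Finset.sum_congr rfl fun j _ => by ring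
      simp_rw [this]
      rw [Finset.sum_comm, hΦ, Finset.mul_sum]
      refine Finset.sum_congr rfl fun j _ => ?_
      rw [← Finset.mul_sum, Finset.sum_add_distrib, ← Finset.mul_sum, ← Finset.mul_sum, hq1, hmean]
      ring
    have hex : ∃ v, (∑ j, Real.exp (l * ∑ k, u (w k) j) * Real.exp (l * u v j)) ≤ (1 + l ^ 2) * Φ := by
      by_contra hcon
      push Not at hcon
      have hpos : ∃ v, 0 < q v := by
        by_contra hc
        push Not at hc
        have : ∑ v, q v ≤ 0 := Finset.sum_nonpos fun v _ => hc v
        linarith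
      obtain ⟨v0, hv0⟩ := hpos
      have := Finset.sum_lt_sum (s := Finset.univ) (fun v _ => mul_le_mul_of_nonneg_left (hcon v).le (hq v))
        ⟨v0, Finset.mem_univ _, mul_lt_mul_of_pos_left (hcon v0) hv0⟩
      linarith
    obtain ⟨v, hv⟩ := hex
    refine ⟨Fin.snoc w v, ?_⟩
    have e2 : ∀ j, Real.exp (l * ∑ k, u ((Fin.snoc w v : Fin (L+1) → V) k) j)
        = Real.exp (l * ∑ k, u (w k) j) * Real.exp (l * u v j) := by
      intro j
      rw [Fin.sum_univ_castSucc]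
      simp [mul_add, Real.exp_add]
    simp_rw [e2]
    have hΦ0 : 0 ≤ Φ := Finset.sum_nonneg fun j _ => (Real.exp_pos _).le
    calc _ ≤ (1 + l ^ 2) * Φ := hv
      _ ≤ Real.exp (l ^ 2) * Φ := by
        apply mul_le_mul_of_nonneg_right _ hΦ0
        have := Real.add_one_le_exp (l ^ 2); linarith
      _ ≤ Real.exp (l ^ 2) * (Fintype.card J * Real.exp (l ^ 2 * L)) :=
        mul_le_mul_of_nonneg_left hw (Real.exp_pos _).le
      _ = _ := by push_cast; rw [mul_add, Real.exp_add]; ring_nf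

/-- the four unit directions -/
noncomputable def sg : Fin 4 → ℂ := ![1, -1, Complex.I, -Complex.I]

lemma sg_norm (b : Fin 4) : ‖sg b‖ = 1 := by
  fin_cases b <;> simp [sg]

lemma norm_le_of_sg (z : ℂ) (B : ℝ) (h : ∀ b, (sg b * z).re ≤ B) : ‖z‖ ≤ 2 * B := by
  have h0 := h 0
  have h1 := h 1
  have h2 := h 2
  have h3 := h 3
  simp [sg] at h0 h1 h2 h3
  have := Complex.norm_le_abs_re_add_abs_im z
  have a1 : |z.re| ≤ B := abs_le.2 ⟨by linarith, by linarith⟩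
  have a2 : |z.im| ≤ B := abs_le.2 ⟨by linarith, by linarith⟩
  linarith

lemma maurey {V : Type*} [Fintype V] {m : ℕ} (hm : 2 ≤ m) (q : V → ℝ) (hq : ∀ v, 0 ≤ q v)
    (hq1 : ∑ v, q v = 1) (A : V → Fin m → ℂ) (M : ℝ) (hM : 0 < M) (hA : ∀ v i, ‖A v i‖ ≤ M)
    (L : ℕ) (hL : Real.log (4 * m) ≤ L) :
    ∃ w : Fin L → V, ∀ i, ‖(∑ k, A (w k) i) - L * ∑ v, (q v : ℂ) * A v i‖
      ≤ 8 * M * Real.sqrt (L * Real.log (4 * m)) := by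
  have hm' : (2 : ℝ) ≤ m := by exact_mod_cast hm
  have hlog : 0 < Real.log (4 * m) := Real.log_pos (by linarith)
  have hLpos : (0 : ℝ) < L := lt_of_lt_of_le hlog hL
  set B : Fin m → ℂ := fun i => ∑ v, (q v : ℂ) * A v i with hB
  have hBn : ∀ i, ‖B i‖ ≤ M := by
    intro i
    calc ‖B i‖ ≤ ∑ v, ‖(q v : ℂ) * A v i‖ := norm_sum_le _ _
      _ ≤ ∑ v, q v * M := by
        refine Finset.sum_le_sum fun v _ => ?_
        rw [norm_mul, Complex.norm_real, Real.norm_of_nonneg (hq v)]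
        exact mul_le_mul_of_nonneg_left (hA v i) (hq v)
      _ = M := by rw [← Finset.sum_mul, hq1, one_mul]
  set u : V → (Fin m × Fin 4) → ℝ := fun v j => (sg j.2 * (A v j.1 - B j.1)).re / (2 * M) with hu
  have hu1 : ∀ v j, |u v j| ≤ 1 := by
    intro v j
    rw [hu]; simp only
    rw [abs_div, abs_of_pos (by positivity : 0 < 2 * M), div_le_one (by positivity)]
    calc _ ≤ ‖sg j.2 * (A v j.1 - B j.1)‖ := Complex.abs_re_le_norm _
      _ = ‖A v j.1 - B j.1‖ := by rw [norm_mul, sg_norm, one_mul]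
      _ ≤ ‖A v j.1‖ + ‖B j.1‖ := norm_sub_le _ _
      _ ≤ 2 * M := by linarith [hA v j.1, hBn j.1]
  have hmean : ∀ j, ∑ v, q v * u v j = 0 := by
    intro j
    have e : ∀ v, q v * u v j = ((sg j.2 * ((q v : ℂ) * A v j.1 - (q v : ℂ) * B j.1))).re / (2 * M) := by
      intro v
      have : sg j.2 * ((q v : ℂ) * A v j.1 - (q v : ℂ) * B j.1)
          = (q v : ℂ) * (sg j.2 * (A v j.1 - B j.1)) := by ring
      rw [this, Complex.re_ofReal_mul, hu]; ring
    simp_rw [e]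
    rw [← Finset.sum_div, ← Complex.re_sum, ← Finset.mul_sum, Finset.sum_sub_distrib, ← Finset.sum_mul]
    have : (∑ v, (q v : ℂ)) = 1 := by exact_mod_cast hq1
    rw [this, one_mul, hB]; simp
  set l : ℝ := Real.sqrt (Real.log (4 * m) / L) with hl
  have hl0 : 0 < l := Real.sqrt_pos.2 (by positivity)
  have hl1 : l ≤ 1 := Real.sqrt_le_one.2 ((div_le_one hLpos).2 hL)
  obtain ⟨w, hw⟩ := greedy q hq hq1 u hu1 hmean l hl0.le hl1 L
  refine ⟨w, fun i => ?_⟩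
  have hl2 : l ^ 2 = Real.log (4 * m) / L := Real.sq_sqrt (by positivity)
  have hlL : l * L = Real.sqrt (L * Real.log (4 * m)) := by
    rw [hl, Real.sqrt_div hlog.le, Real.sqrt_mul hLpos.le]
    have := Real.mul_self_sqrt hLpos.le
    have h3 : Real.sqrt L ≠ 0 := (Real.sqrt_pos.2 hLpos).ne'
    field_simp
    rw [sq, this]
  have hsum : ∀ j, ∑ k, u (w k) j ≤ 2 * (l * L) := by
    intro j
    have h1 : Real.exp (l * ∑ k, u (w k) j) ≤ (4 * m) * Real.exp (l ^ 2 * L) := by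
      refine le_trans ?_ (hw.trans (le_of_eq ?_))
      · exact Finset.single_le_sum (f := fun j => Real.exp (l * ∑ k, u (w k) j))
          (fun j _ => (Real.exp_pos _).le) (Finset.mem_univ j)
      · simp; ring
    have h2 : (4 * m : ℝ) * Real.exp (l ^ 2 * L) = Real.exp (2 * l ^ 2 * L) := by
      have : (4 * m : ℝ) = Real.exp (l ^ 2 * L) := by
        rw [hl2, div_mul_cancel₀ _ hLpos.ne', Real.exp_log (by positivity)]
      rw [this, ← Real.exp_add]; ring_nf
    rw [h2, Real.exp_le_exp] at h1
    have : l * ∑ k, u (w k) j ≤ l * (2 * (l * L)) := by linarith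
    exact le_of_mul_le_mul_left this hl0
  have hfin : ∀ b, (sg b * ((∑ k, A (w k) i) - L * B i)).re ≤ 4 * M * (l * L) := by
    intro b
    have h := hsum (i, b)
    have e : ∑ k, u (w k) (i, b) = (sg b * ((∑ k, A (w k) i) - L * B i)).re / (2 * M) := by
      rw [hu]; simp only
      rw [← Finset.sum_div, ← Complex.re_sum, ← Finset.mul_sum, Finset.sum_sub_distrib]
      simp
    rw [e, div_le_iff₀ (by positivity)] at h
    linarith
  have := norm_le_of_sg _ _ hfin
  rw [← hlL]; linarith

lemma sg_decomp (z : ℂ) : ∑ b, ((max 0 (sg b * z).re : ℝ) : ℂ) * sg b = (starRingEnd ℂ) z := by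
  rw [Fin.sum_univ_four]
  apply Complex.ext
  · simp [sg]
    rcases le_total 0 z.re with h | h <;> simp [h]
  · simp [sg]
    rcases le_total 0 z.im with h | h <;> simp [h]

lemma sg_sum_le (z : ℂ) : ∑ b, max 0 (sg b * z).re ≤ 2 * ‖z‖ := by
  rw [Fin.sum_univ_four]
  have h1 := abs_le.1 (Complex.abs_re_le_norm z)
  have h2 := abs_le.1 (Complex.abs_im_le_norm z)
  simp [sg]
  rcases le_total 0 z.re with h | h <;> rcases le_total 0 z.im with h' | h' <;> simp [h, h'] <;> linarith

/-- centers for Maurey -/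
noncomputable def vec {n : ℕ} : Option (Fin n × Fin 4) → Fin n → ℂ
  | none => 0
  | some p => Pi.single p.1 ((starRingEnd ℂ) (sg p.2))

lemma vec_phi_some {n : ℕ} (y : Fin n → ℂ) (a : Fin n) (b : Fin 4) :
    ∑ a', (starRingEnd ℂ) (vec (some (a, b)) a') * y a' = sg b * y a := by
  rw [Finset.sum_eq_single a]
  · simp [vec]
  · intro c _ hc; simp [vec, hc]
  · simp

lemma vec_phi_none {n : ℕ} (y : Fin n → ℂ) :
    ∑ a', (starRingEnd ℂ) (vec (none : Option (Fin n × Fin 4)) a') * y a' = 0 := by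
  simp [vec]

lemma approx {n m : ℕ} (hm : 2 ≤ m) (xs : Fin m → Fin n → ℂ) (M : ℝ) (hM : 0 < M)
    (hxs : ∀ i a, ‖xs i a‖ ≤ M) (x : Fin n → ℂ) (r : ℝ) (hr : 0 < r) (hx : ∑ a, ‖x a‖ ≤ r)
    (L : ℕ) (hL : Real.log (4 * m) ≤ L) :
    ∃ w : Fin L → Option (Fin n × Fin 4), ∀ i,
      ‖∑ a, (starRingEnd ℂ) (x a - ((2 * r / L : ℝ) : ℂ) * ∑ k, vec (w k) a) * xs i a‖ ≤
        16 * r * M * Real.sqrt (Real.log (4 * m)) / Real.sqrt L := by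
  have hm' : (2 : ℝ) ≤ m := by exact_mod_cast hm
  have hlog : 0 < Real.log (4 * m) := Real.log_pos (by linarith)
  have hLpos : (0 : ℝ) < L := lt_of_lt_of_le hlog hL
  set q0 : Fin n × Fin 4 → ℝ := fun p => max 0 (sg p.2 * x p.1).re / (2 * r) with hq0
  have hq00 : ∀ p, 0 ≤ q0 p := fun p => by rw [hq0]; positivity
  have hq0s : ∑ p, q0 p ≤ 1 := by
    rw [hq0, ← Finset.sum_div, div_le_one (by positivity), Fintype.sum_prod_type]
    calc _ ≤ ∑ a, 2 * ‖x a‖ := Finset.sum_le_sum fun a _ => sg_sum_le (x a)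
      _ = 2 * ∑ a, ‖x a‖ := by rw [Finset.mul_sum]
      _ ≤ 2 * r := by linarith
  set q : Option (Fin n × Fin 4) → ℝ := fun v => v.elim (1 - ∑ p, q0 p) q0 with hq
  obtain ⟨w, hw⟩ := maurey hm q (by
      intro v; cases v with
      | none => simp only [hq, Option.elim]; linarith
      | some p => exact hq00 p)
    (by rw [Fintype.sum_option]; simp [hq])
    (fun v i => ∑ a, (starRingEnd ℂ) (vec v a) * xs i a) M hM (by
      intro v i
      cases v with
      | none => rw [vec_phi_none]; simp [hM.le]
      | some p => obtain ⟨a, b⟩ := p; rw [vec_phi_some, norm_mul, sg_norm, one_mul]; exact hxs i a)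
    L hL
  refine ⟨w, fun i => ?_⟩
  have hmean : ∑ v, (q v : ℂ) * (∑ a, (starRingEnd ℂ) (vec v a) * xs i a)
      = (∑ a, (starRingEnd ℂ) (x a) * xs i a) / (2 * r : ℝ) := by
    rw [Fintype.sum_option, vec_phi_none, mul_zero, zero_add, Fintype.sum_prod_type, Finset.sum_div]
    refine Finset.sum_congr rfl fun a _ => ?_
    rw [← sg_decomp (x a), Finset.sum_mul, Finset.sum_div]
    refine Finset.sum_congr rfl fun b _ => ?_
    rw [vec_phi_some]
    simp only [hq, hq0, Option.elim]
    push_cast; ring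
  have h := hw i
  rw [hmean] at h
  have hr' : (r : ℂ) ≠ 0 := by exact_mod_cast hr.ne'
  have hL' : (L : ℂ) ≠ 0 := by exact_mod_cast hLpos.ne'
  have e : ∑ a, (starRingEnd ℂ) (x a - ((2 * r / L : ℝ) : ℂ) * ∑ k, vec (w k) a) * xs i a
      = -((2 * r / L : ℝ) : ℂ) * ((∑ k, ∑ a, (starRingEnd ℂ) (vec (w k) a) * xs i a) -
        L * ((∑ a, (starRingEnd ℂ) (x a) * xs i a) / (2 * r : ℝ))) := by
    rw [mul_sub, Finset.sum_comm]
    have e1 : -((2 * r / L : ℝ) : ℂ) * (L * ((∑ a, (starRingEnd ℂ) (x a) * xs i a) / (2 * r : ℝ)))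
      = - ∑ a, (starRingEnd ℂ) (x a) * xs i a := by
      push_cast; field_simp
    rw [e1, sub_neg_eq_add, Finset.mul_sum, ← Finset.sum_add_distrib]
    refine Finset.sum_congr rfl fun a _ => ?_
    rw [← Finset.sum_mul, map_sub, map_mul, Complex.conj_ofReal, map_sum]
    ring
  rw [e, norm_mul, norm_neg, Complex.norm_real, Real.norm_of_nonneg (by positivity)]
  calc _ ≤ 2 * r / L * (8 * M * Real.sqrt (L * Real.log (4 * m))) :=
        mul_le_mul_of_nonneg_left h (by positivity)
    _ = _ := by
      rw [Real.sqrt_mul hLpos.le]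
      have h2 := Real.mul_self_sqrt hLpos.le
      have h3 : Real.sqrt L ≠ 0 := (Real.sqrt_pos.2 hLpos).ne'
      field_simp
      rw [sq, h2]; ring

/-- the set of sparse unit vectors -/
def Tp (n s : ℕ) : Set (Fin n → ℂ) :=
  {x : Fin n → ℂ | ∃ Γ : Finset (Fin n), Γ.card ≤ s ∧ (∀ i, i ∉ Γ → x i = 0) ∧
            (∑ i, ‖x i‖ ^ 2) = 1}

/-- the distance of the seminorm -/
noncomputable def dX {n m : ℕ} (xs : Fin m → Fin n → ℂ) (x y : Fin n → ℂ) : ℝ :=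
  ⨆ i : Fin m, ‖∑ a, (starRingEnd ℂ) (x a - y a) * xs i a‖

lemma Tp_l1 {n s : ℕ} {x : Fin n → ℂ} (hx : x ∈ Tp n s) : ∑ a, ‖x a‖ ≤ Real.sqrt s := by
  obtain ⟨Γ, hc, h0, h1⟩ := hx
  have e : ∑ a, ‖x a‖ = ∑ a ∈ Γ, ‖x a‖ := by
    symm
    apply Finset.sum_subset (Finset.subset_univ _)
    intro a _ ha; rw [h0 a ha, norm_zero]
  rw [e]
  apply Real.le_sqrt_of_sq_le
  have h2 := sq_sum_le_card_mul_sum_sq (s := Γ) (f := fun a => ‖x a‖)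
  have h3 : ∑ a ∈ Γ, ‖x a‖ ^ 2 ≤ 1 := by
    rw [← h1]
    exact Finset.sum_le_sum_of_subset_of_nonneg (Finset.subset_univ _) (fun a _ _ => by positivity)
  have h4 : (Γ.card : ℝ) ≤ s := by exact_mod_cast hc
  calc _ ≤ _ := h2
    _ ≤ (Γ.card : ℝ) * 1 := mul_le_mul_of_nonneg_left h3 (by positivity)
    _ ≤ s := by linarith

lemma phi_le {n m : ℕ} (xs : Fin m → Fin n → ℂ) (M : ℝ)
    (hxs : ∀ i a, ‖xs i a‖ ≤ M) (x : Fin n → ℂ) (i : Fin m) :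
    ‖∑ a, (starRingEnd ℂ) (x a) * xs i a‖ ≤ M * ∑ a, ‖x a‖ := by
  calc _ ≤ ∑ a, ‖(starRingEnd ℂ) (x a) * xs i a‖ := norm_sum_le _ _
    _ ≤ ∑ a, M * ‖x a‖ := by
      refine Finset.sum_le_sum fun a _ => ?_
      rw [norm_mul, RCLike.norm_conj, mul_comm]
      exact mul_le_mul_of_nonneg_right (hxs i a) (norm_nonneg _)
    _ = _ := by rw [Finset.mul_sum]

lemma dX_le {n m : ℕ} (xs : Fin m → Fin n → ℂ) (x y : Fin n → ℂ) (t : ℝ) (ht : 0 ≤ t)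
    (h : ∀ i, ‖∑ a, (starRingEnd ℂ) (x a - y a) * xs i a‖ ≤ t) : dX xs x y ≤ t :=
  Real.iSup_le h ht

lemma big_t {n m s : ℕ} (xs : Fin m → Fin n → ℂ) (M : ℝ) (hM : 0 ≤ M)
    (hxs : ∀ i a, ‖xs i a‖ ≤ M) (t : ℝ) (ht : M * Real.sqrt s ≤ t) :
    Real.sqrt (Real.log ((coveringNumber (Tp n s) (dX xs) t).toNat : ℝ)) = 0 := by
  apply Real.sqrt_eq_zero_of_nonpos
  refine (cov_log_le (ι := Unit) _ _ t (fun _ => 0) ?_).trans (by simp)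
  intro x hx
  refine ⟨(), dX_le _ _ _ _ (le_trans (by positivity) ht) fun i => ?_⟩
  simp only [Pi.zero_apply, sub_zero]
  exact (phi_le xs M hxs x i).trans ((mul_le_mul_of_nonneg_left (Tp_l1 hx) hM).trans ht)

lemma mid_t {n m s : ℕ} (hn : 2 ≤ n) (hm : 2 ≤ m) (hs : 2 ≤ s)
    (xs : Fin m → Fin n → ℂ) (M : ℝ) (hM : 0 < M)
    (hxs : ∀ i a, ‖xs i a‖ ≤ M) (t : ℝ) (ht0 : 0 < t) (ht : t ≤ M * Real.sqrt s) :
    Real.sqrt (Real.log ((coveringNumber (Tp n s) (dX xs) t).toNat : ℝ)) ≤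
      60 * M * Real.sqrt s * Real.sqrt (Real.log m) * Real.sqrt (Real.log n) * t⁻¹ := by
  have hm' : (2 : ℝ) ≤ m := by exact_mod_cast hm
  have hn' : (2 : ℝ) ≤ n := by exact_mod_cast hn
  have hs' : (2 : ℝ) ≤ s := by exact_mod_cast hs
  have hlog : 0 < Real.log (4 * m) := Real.log_pos (by linarith)
  have hlm : Real.log (4 * m) ≤ 3 * Real.log m := by
    have : Real.log (4 * m) ≤ Real.log ((m : ℝ) ^ 3) :=
      Real.log_le_log (by positivity) (by nlinarith [mul_nonneg (sub_nonneg.2 hm') (sub_nonneg.2 hm')])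
    rwa [Real.log_pow] at this
  have hln : Real.log (4 * n + 1) ≤ 4 * Real.log n := by
    have : Real.log (4 * n + 1) ≤ Real.log ((n : ℝ) ^ 4) := by
      refine Real.log_le_log (by positivity) ?_
      have h2 : (4 : ℝ) ≤ n ^ 2 := by nlinarith
      nlinarith
    rwa [Real.log_pow] at this
  have hss : Real.sqrt s ^ 2 = s := Real.sq_sqrt (by positivity)
  set r := Real.sqrt s with hr
  have hrpos : 0 < r := Real.sqrt_pos.2 (by linarith)
  set D : ℝ := (M * r / t) ^ 2 * Real.log (4 * m) with hD
  have hMrt : 1 ≤ M * r / t := (one_le_div ht0).2 ht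
  have hDl : Real.log (4 * m) ≤ D := by
    rw [hD]; exact le_mul_of_one_le_left hlog.le (one_le_pow₀ hMrt)
  have hD1 : 1 ≤ D := by
    refine le_trans ?_ hDl
    rw [Real.le_log_iff_exp_le (by positivity)]
    have := Real.exp_one_lt_d9
    linarith
  set L : ℕ := ⌈256 * D⌉₊ with hLdef
  have hL1 : 256 * D ≤ L := Nat.le_ceil _
  have hL2 : (L : ℝ) ≤ 257 * D := by
    have := Nat.ceil_lt_add_one (a := 256 * D) (by positivity)
    rw [← hLdef] at this; linarith
  have hLlog : Real.log (4 * m) ≤ L := by linarith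
  have hcov := cov_log_le (Tp n s) (dX xs) t
    (fun (w : Fin L → Option (Fin n × Fin 4)) a => ((2 * r / L : ℝ) : ℂ) * ∑ k, vec (w k) a) (by
      intro x hx
      obtain ⟨w, hw⟩ := approx hm xs M hM hxs x r hrpos (Tp_l1 hx) L hLlog
      refine ⟨w, dX_le _ _ _ _ ht0.le fun i => (hw i).trans ?_⟩
      have hLpos : (0:ℝ) < L := by linarith
      rw [div_le_iff₀ (Real.sqrt_pos.2 hLpos)]
      have h1 : 16 * (M * r / t) * Real.sqrt (Real.log (4 * m)) ≤ Real.sqrt L := by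
        apply Real.le_sqrt_of_sq_le
        rw [mul_pow, mul_pow, Real.sq_sqrt hlog.le]
        rw [hD] at hL1
        linarith
      calc 16 * r * M * Real.sqrt (Real.log (4 * m))
          = t * (16 * (M * r / t) * Real.sqrt (Real.log (4 * m))) := by field_simp
        _ ≤ t * Real.sqrt L := mul_le_mul_of_nonneg_left h1 ht0.le)
  have hcard : (Fintype.card (Fin L → Option (Fin n × Fin 4)) : ℝ) = (4 * n + 1 : ℝ) ^ L := by
    simp; ring
  rw [hcard, Real.log_pow] at hcov
  have hlogn : 0 ≤ Real.log n := Real.log_nonneg (by linarith)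
  have hlogm : 0 ≤ Real.log m := Real.log_nonneg (by linarith)
  apply Real.sqrt_le_iff.2
  refine ⟨by positivity, hcov.trans ?_⟩
  have e : (60 * M * r * Real.sqrt (Real.log m) * Real.sqrt (Real.log n) * t⁻¹) ^ 2
      = 3600 * (M * r / t) ^ 2 * Real.log m * Real.log n := by
    rw [mul_pow, mul_pow, mul_pow, Real.sq_sqrt hlogn, Real.sq_sqrt hlogm]; ring
  rw [e]
  calc (L : ℝ) * Real.log (4 * n + 1) ≤ (257 * D) * (4 * Real.log n) :=
        mul_le_mul hL2 hln (Real.log_nonneg (by linarith)) (by positivity)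
    _ ≤ (257 * ((M * r / t) ^ 2 * (3 * Real.log m))) * (4 * Real.log n) := by
        rw [hD]; gcongr
    _ ≤ _ := by
        have : 0 ≤ (M * r / t) ^ 2 * Real.log m * Real.log n := by positivity
        nlinarith

lemma grid1 (K : ℕ) (hK : 0 < K) (y : ℝ) (hy : |y| ≤ 1) :
    ∃ p : Fin (K + 1), |y - (-1 + 2 * (p : ℕ) / K)| ≤ 2 / K := by
  have hK' : (0 : ℝ) < K := by exact_mod_cast hK
  obtain ⟨h1, h2⟩ := abs_le.1 hy
  have h0 : 0 ≤ (y + 1) * K / 2 := by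
    have : 0 ≤ y + 1 := by linarith
    positivity
  have hle : ⌊(y + 1) * K / 2⌋₊ ≤ K := by
    apply Nat.floor_le_of_le
    nlinarith
  refine ⟨⟨⌊(y + 1) * K / 2⌋₊, by omega⟩, ?_⟩
  have a1 := Nat.floor_le h0
  have a2 := Nat.lt_floor_add_one ((y + 1) * K / 2)
  simp only
  set f : ℝ := (⌊(y + 1) * K / 2⌋₊ : ℝ)
  have e : y - (-1 + 2 * f / K) = (2 / K) * ((y + 1) * K / 2 - f) := by field_simp; ring
  rw [e, abs_mul, abs_of_pos (by positivity)]
  apply mul_le_of_le_one_right (by positivity)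
  rw [abs_le]; constructor <;> linarith

/-- complex grid point -/
noncomputable def gpt (K : ℕ) (p : Fin (K + 1) × Fin (K + 1)) : ℂ :=
  ⟨-1 + 2 * (p.1 : ℕ) / K, -1 + 2 * (p.2 : ℕ) / K⟩

lemma grid2 (K : ℕ) (hK : 0 < K) (z : ℂ) (hz : ‖z‖ ≤ 1) :
    ∃ p, ‖z - gpt K p‖ ≤ 4 / K := by
  obtain ⟨p, hp⟩ := grid1 K hK z.re ((Complex.abs_re_le_norm z).trans hz)
  obtain ⟨q, hq⟩ := grid1 K hK z.im ((Complex.abs_im_le_norm z).trans hz)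
  refine ⟨(p, q), (Complex.norm_le_abs_re_add_abs_im _).trans ?_⟩
  simp only [gpt, Complex.sub_re, Complex.sub_im]
  calc _ ≤ (2 : ℝ) / K + 2 / K := add_le_add hp hq
    _ = _ := by ring

lemma Tp_decomp {n s : ℕ} (hn : 0 < n) {x : Fin n → ℂ} (hx : x ∈ Tp n s) :
    ∃ (f : Fin s → Fin n) (c : Fin s → ℂ), (∀ j, ‖c j‖ ≤ 1) ∧
      x = ∑ j, Pi.single (f j) (c j) := by
  classical
  obtain ⟨Γ, hc, h0, h1⟩ := hx
  have hx1 : ∀ a, ‖x a‖ ≤ 1 := by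
    intro a
    have : ‖x a‖ ^ 2 ≤ 1 := by
      rw [← h1]
      exact Finset.single_le_sum (f := fun a => ‖x a‖ ^ 2) (fun _ _ => by positivity) (Finset.mem_univ a)
    exact (sq_le_one_iff₀ (norm_nonneg _)).1 this
  have hcard : Fintype.card Γ ≤ Fintype.card (Fin s) := by simpa using hc
  obtain ⟨g⟩ := Function.Embedding.nonempty_of_card_le hcard
  refine ⟨Function.extend g (fun a => (a : Fin n)) (fun _ => ⟨0, hn⟩),
    Function.extend g (fun a => x a) (fun _ => 0), ?_, ?_⟩
  · intro j
    by_cases hj : ∃ a, g a = j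
    · obtain ⟨a, rfl⟩ := hj
      rw [g.injective.extend_apply]; exact hx1 _
    · rw [Function.extend_apply' _ _ _ hj]; simp
  · have e : ∑ j, (Pi.single (Function.extend g (fun a => (a : Fin n)) (fun _ => ⟨0, hn⟩) j)
        (Function.extend g (fun a => x a) (fun _ => (0:ℂ)) j) : Fin n → ℂ)
        = ∑ a : Γ, Pi.single (a : Fin n) (x a) := by
      symm
      apply Finset.sum_of_injOn g g.injective.injOn (by simp)
      · intro j _ hj
        have hj' : ¬ ∃ a, g a = j := by
          rintro ⟨a, rfl⟩; exact hj ⟨a, by simp, rfl⟩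
        rw [Function.extend_apply' (fun a : Γ => x a) _ _ hj', Pi.single_zero]
      · intro a _
        rw [g.injective.extend_apply, g.injective.extend_apply]
    rw [e, Finset.sum_coe_sort Γ (fun a => (Pi.single a (x a) : Fin n → ℂ))]
    conv_lhs => rw [← Finset.univ_sum_single x]
    symm
    apply Finset.sum_subset (Finset.subset_univ _)
    intro a _ ha; rw [h0 a ha, Pi.single_zero]

lemma l1_single {n s : ℕ} (f : Fin s → Fin n) (c : Fin s → ℂ) :
    ∑ a, ‖(∑ j, (Pi.single (f j) (c j) : Fin n → ℂ)) a‖ ≤ ∑ j, ‖c j‖ := by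
  calc _ ≤ ∑ a, ∑ j, ‖(Pi.single (f j) (c j) : Fin n → ℂ) a‖ := by
        refine Finset.sum_le_sum fun a _ => ?_
        rw [Finset.sum_apply]; exact norm_sum_le _ _
    _ = ∑ j, ‖c j‖ := by
        rw [Finset.sum_comm]
        refine Finset.sum_congr rfl fun j _ => ?_
        rw [Finset.sum_eq_single (f j)]
        · simp
        · intro a _ ha; simp [ha]
        · simp

lemma small_t {n m s : ℕ} (hn : 2 ≤ n) (hs : 2 ≤ s)
    (xs : Fin m → Fin n → ℂ) (M : ℝ) (hM : 0 < M)
    (hxs : ∀ i a, ‖xs i a‖ ≤ M) (t : ℝ) (ht0 : 0 < t) (ht : t ≤ M) :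
    Real.sqrt (Real.log ((coveringNumber (Tp n s) (dX xs) t).toNat : ℝ)) ≤
      Real.sqrt s * (Real.sqrt (Real.log n) + 3 * Real.sqrt (Real.log s)
        + 2 * Real.sqrt M * t ^ (-(1/2) : ℝ)) := by
  have hn' : (2 : ℝ) ≤ n := by exact_mod_cast hn
  have hs' : (2 : ℝ) ≤ s := by exact_mod_cast hs
  have hMt : 1 ≤ M / t := (one_le_div ht0).2 ht
  have hpos : 0 < 4 * (M / t) * s := by positivity
  set K : ℕ := ⌈4 * (M / t) * s⌉₊ with hK
  have hK1 : 4 * (M / t) * s ≤ K := Nat.le_ceil _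
  have hK2 : (K : ℝ) < 4 * (M / t) * s + 1 := Nat.ceil_lt_add_one hpos.le
  have hK0 : 0 < K := Nat.ceil_pos.2 hpos
  have hKr : (0:ℝ) < K := by exact_mod_cast hK0
  have hcov := cov_log_le (Tp n s) (dX xs) t
    (fun (w : (Fin s → Fin n) × (Fin s → Fin (K + 1) × Fin (K + 1))) =>
      ∑ j, (Pi.single (w.1 j) (gpt K (w.2 j)) : Fin n → ℂ)) (by
      intro x hx
      obtain ⟨f, c, hc, rfl⟩ := Tp_decomp (by omega) hx
      choose g hg using fun j => grid2 K hK0 (c j) (hc j)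
      refine ⟨(f, g), dX_le _ _ _ _ ht0.le fun i => ?_⟩
      have e : ∀ a, (∑ j, (Pi.single (f j) (c j) : Fin n → ℂ)) a
          - (∑ j, (Pi.single (f j) (gpt K (g j)) : Fin n → ℂ)) a
          = (∑ j, (Pi.single (f j) (c j - gpt K (g j)) : Fin n → ℂ)) a := by
        intro a
        simp only [Pi.single_sub, Finset.sum_sub_distrib, Pi.sub_apply]
      simp only [e]
      refine (phi_le xs M hxs _ i).trans ?_
      have h1 : ∑ j, ‖c j - gpt K (g j)‖ ≤ s * (4 / K) := by
        calc _ ≤ ∑ j : Fin s, (4 : ℝ) / K := Finset.sum_le_sum fun j _ => hg j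
          _ = _ := by simp
      calc _ ≤ M * (s * (4 / K)) := mul_le_mul_of_nonneg_left ((l1_single _ _).trans h1) hM.le
        _ ≤ t := by
          have : 4 * M * s ≤ t * K := by
            calc 4 * M * s = t * (4 * (M / t) * s) := by field_simp
              _ ≤ t * K := mul_le_mul_of_nonneg_left hK1 ht0.le
          have e2 : M * (s * (4 / K)) = (4 * M * s) / K := by ring
          rw [e2, div_le_iff₀ hKr]; exact this)
  have hcard : (Fintype.card ((Fin s → Fin n) × (Fin s → Fin (K + 1) × Fin (K + 1))) : ℝ)
      = (n * (K + 1) ^ 2 : ℝ) ^ s := by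
    rw [mul_pow, sq]; simp
  rw [hcard, Real.log_pow, Real.log_mul (by positivity) (by positivity), Real.log_pow] at hcov
  have hlogn : 0 ≤ Real.log n := Real.log_nonneg (by linarith)
  have hlogs : 0 ≤ Real.log s := Real.log_nonneg (by linarith)
  have hlK : Real.log (K + 1) ≤ 4 * Real.log s + M / t := by
    have h1 : (K + 1 : ℝ) ≤ s ^ 4 * (M / t) := by
      have h3 : 2 ≤ (M / t) * s := by nlinarith
      have h4 : 6 * (s : ℝ) ≤ s ^ 4 := by
        have : (8 : ℝ) ≤ s ^ 3 := by
          calc (8 : ℝ) = 2 ^ 3 := by norm_num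
            _ ≤ s ^ 3 := pow_le_pow_left₀ (by norm_num) hs' 3
        nlinarith
      calc (K + 1 : ℝ) ≤ 6 * s * (M / t) := by linarith
        _ ≤ _ := mul_le_mul_of_nonneg_right h4 (by positivity)
    have h2 := Real.log_le_log (by positivity) h1
    rw [Real.log_mul (by positivity) (by positivity), Real.log_pow] at h2
    have h5 := Real.log_le_sub_one_of_pos (by positivity : 0 < M / t)
    push_cast at h2
    linarith
  have htr : t ^ (-(1/2) : ℝ) = (Real.sqrt t)⁻¹ := by
    rw [Real.rpow_neg ht0.le, Real.sqrt_eq_rpow]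
  have hsq : (Real.sqrt M * t ^ (-(1/2) : ℝ)) ^ 2 = M / t := by
    rw [htr, mul_pow, inv_pow, Real.sq_sqrt hM.le, Real.sq_sqrt ht0.le]; rfl
  set X := Real.sqrt M * t ^ (-(1/2) : ℝ) with hX
  have hX0 : 0 ≤ X := by positivity
  set a := Real.sqrt (Real.log n) with ha
  set b := Real.sqrt (Real.log s) with hb
  have ha2 : a ^ 2 = Real.log n := Real.sq_sqrt hlogn
  have hb2 : b ^ 2 = Real.log s := Real.sq_sqrt hlogs
  have ha0 : 0 ≤ a := Real.sqrt_nonneg _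
  have hb0 : 0 ≤ b := Real.sqrt_nonneg _
  have e3 : 2 * Real.sqrt M * t ^ (-(1/2) : ℝ) = 2 * X := by rw [hX]; ring
  rw [e3]
  apply Real.sqrt_le_iff.2
  refine ⟨by positivity, hcov.trans ?_⟩
  rw [mul_pow, Real.sq_sqrt (by positivity)]
  apply mul_le_mul_of_nonneg_left _ (by positivity)
  push_cast
  nlinarith [mul_nonneg ha0 hb0, mul_nonneg ha0 hX0, mul_nonneg hb0 hX0, sq_nonneg b, sq_nonneg X]

lemma const_bound {n m s : ℕ} (hn : 2 ≤ n) (hm : 2 ≤ m) (hs : 2 ≤ s) :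
    Real.sqrt (Real.log n) + 3 * Real.sqrt (Real.log s) + 4
      ≤ 20 * (Real.log s * Real.sqrt (Real.log m) * Real.sqrt (Real.log n)) := by
  have key : ∀ k : ℕ, 2 ≤ k → 0.8 ≤ Real.sqrt (Real.log k) := by
    intro k hk
    apply Real.le_sqrt_of_sq_le
    have : Real.log 2 ≤ Real.log k := Real.log_le_log (by norm_num) (by exact_mod_cast hk)
    have := Real.log_two_gt_d9
    norm_num; linarith
  have h1 := key n hn
  have h2 := key m hm
  have h3 := key s hs
  have hlogs : 0 ≤ Real.log s := Real.log_natCast_nonneg _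
  rw [← Real.sq_sqrt hlogs]
  rw [Real.sqrt_sq (Real.sqrt_nonneg _)]
  set a := Real.sqrt (Real.log n)
  set b := Real.sqrt (Real.log m)
  set c := Real.sqrt (Real.log s)
  have p1 : 0.64 * a ≤ c ^ 2 * a := mul_le_mul_of_nonneg_right (by nlinarith) (by linarith)
  have p2 : 0.64 * c ≤ c ^ 2 * a := by nlinarith [mul_nonneg (sub_nonneg.2 h3) (sub_nonneg.2 h1)]
  have p3 : 0.51 ≤ c ^ 2 * a := by nlinarith
  have p4 : 0.8 * (c ^ 2 * a) ≤ c ^ 2 * b * a := by nlinarith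
  linarith

lemma main_bound {n m s : ℕ} (hn : 2 ≤ n) (hm : 2 ≤ m) (hs : 2 ≤ s)
    (xs : Fin m → Fin n → ℂ) (M : ℝ) (hM : 0 < M) (hxs : ∀ i a, ‖xs i a‖ ≤ M) :
    (∫ t in Set.Ioi (0 : ℝ),
        Real.sqrt (Real.log ((coveringNumber (Tp n s) (dX xs) t).toNat : ℝ)))
      ≤ 100 * M * Real.sqrt s * Real.log s * Real.sqrt (Real.log m) * Real.sqrt (Real.log n) := by
  have hs' : (2 : ℝ) ≤ s := by exact_mod_cast hs
  set r := Real.sqrt s with hr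
  have hr1 : 1 ≤ r := Real.one_le_sqrt.2 (by linarith)
  have hMr : M ≤ M * r := le_mul_of_one_le_right hM.le hr1
  set p : ℝ := r * (Real.sqrt (Real.log n) + 3 * Real.sqrt (Real.log s)) with hp
  set q : ℝ := r * (2 * Real.sqrt M) with hq
  set A : ℝ := 60 * M * r * Real.sqrt (Real.log m) * Real.sqrt (Real.log n) with hA
  set g1 : ℝ → ℝ := fun t => p + q * t ^ (-(1/2) : ℝ) with hg1
  set g2 : ℝ → ℝ := fun t => A * t⁻¹ with hg2
  have hi1 : MeasureTheory.IntegrableOn g1 (Set.Ioc 0 M) := by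
    rw [← intervalIntegrable_iff_integrableOn_Ioc_of_le hM.le]
    exact intervalIntegrable_const.add
      ((intervalIntegral.intervalIntegrable_rpow' (by norm_num)).const_mul q)
  have hi2 : MeasureTheory.IntegrableOn g2 (Set.Ioc M (M * r)) := by
    rw [← intervalIntegrable_iff_integrableOn_Ioc_of_le hMr]
    apply IntervalIntegrable.const_mul
    apply intervalIntegral.intervalIntegrable_inv
    · intro x hx
      rw [Set.uIcc_of_le hMr] at hx
      have := hx.1
      linarith
    · exact continuousOn_id
  have hI1 : ∫ t in Set.Ioc 0 M, g1 t = M * r * (Real.sqrt (Real.log n) + 3 * Real.sqrt (Real.log s) + 4) := by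
    rw [← intervalIntegral.integral_of_le hM.le, hg1, intervalIntegral.integral_add
      intervalIntegrable_const ((intervalIntegral.intervalIntegrable_rpow' (by norm_num)).const_mul q),
      intervalIntegral.integral_const_mul (r := q), integral_rpow (Or.inl (by norm_num))]
    have e : (-(1/2) + 1 : ℝ) = 1 / 2 := by norm_num
    rw [e, ← Real.sqrt_eq_rpow, Real.zero_rpow (by norm_num)]
    simp only [intervalIntegral.integral_const, smul_eq_mul, sub_zero]
    have := Real.mul_self_sqrt hM.le
    rw [hp, hq]
    linear_combination (4 * r) * this
  have hI2 : ∫ t in Set.Ioc M (M * r), g2 t = A * (Real.log s / 2) := by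
    rw [← intervalIntegral.integral_of_le hMr, hg2, intervalIntegral.integral_const_mul,
      integral_inv_of_pos hM (by positivity)]
    congr 1
    rw [mul_div_cancel_left₀ _ hM.ne', hr, Real.log_sqrt (by positivity)]
  set G : ℝ → ℝ := fun t => (Set.Ioc 0 M).indicator g1 t + (Set.Ioc M (M * r)).indicator g2 t with hG
  have hj1 : MeasureTheory.Integrable ((Set.Ioc 0 M).indicator g1) :=
    hi1.integrable_indicator measurableSet_Ioc
  have hj2 : MeasureTheory.Integrable ((Set.Ioc M (M * r)).indicator g2) :=
    hi2.integrable_indicator measurableSet_Ioc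
  have hle : (∫ t in Set.Ioi (0 : ℝ),
        Real.sqrt (Real.log ((coveringNumber (Tp n s) (dX xs) t).toNat : ℝ)))
      ≤ ∫ t in Set.Ioi (0 : ℝ), G t := by
    apply MeasureTheory.integral_mono_of_nonneg
    · exact Filter.Eventually.of_forall fun t => Real.sqrt_nonneg _
    · exact (hj1.add hj2).integrableOn
    · refine (MeasureTheory.ae_restrict_iff' measurableSet_Ioi).2 (Filter.Eventually.of_forall ?_)
      intro t ht
      have ht0 : 0 < t := ht
      simp only [hG]
      rcases le_or_gt t M with h | h
      · rw [Set.indicator_of_mem (show t ∈ Set.Ioc 0 M from ⟨ht0, h⟩),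
          Set.indicator_of_notMem (fun h' => absurd h'.1 (not_lt.2 h)), add_zero]
        refine (small_t hn hs xs M hM hxs t ht0 h).trans (le_of_eq ?_)
        simp only [hg1, hp, hq]; ring
      · rw [Set.indicator_of_notMem (fun h' : t ∈ Set.Ioc 0 M => absurd h'.2 (not_le.2 h)), zero_add]
        rcases le_or_gt t (M * r) with h2 | h2
        · rw [Set.indicator_of_mem (show t ∈ Set.Ioc M (M * r) from ⟨h, h2⟩)]
          exact mid_t hn hm hs xs M hM hxs t ht0 h2
        · rw [Set.indicator_of_notMem (fun h' : t ∈ Set.Ioc M (M * r) => absurd h'.2 (not_le.2 h2))]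
          exact (big_t xs M hM.le hxs t h2.le).le
  have hGi : ∫ t in Set.Ioi (0 : ℝ), G t
      = M * r * (Real.sqrt (Real.log n) + 3 * Real.sqrt (Real.log s) + 4) + A * (Real.log s / 2) := by
    rw [hG, MeasureTheory.integral_add hj1.integrableOn hj2.integrableOn,
      MeasureTheory.setIntegral_indicator measurableSet_Ioc,
      MeasureTheory.setIntegral_indicator measurableSet_Ioc,
      Set.inter_eq_self_of_subset_right (show Set.Ioc 0 M ⊆ Set.Ioi 0 from fun t ht => ht.1),
      Set.inter_eq_self_of_subset_right
        (show Set.Ioc M (M * r) ⊆ Set.Ioi 0 from fun t ht => hM.trans ht.1), hI1, hI2]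
  rw [hGi] at hle
  have hc := const_bound hn hm hs
  have hc2 := mul_le_mul_of_nonneg_left hc (show 0 ≤ M * r by positivity)
  have hpos : 0 ≤ M * r * Real.log s * Real.sqrt (Real.log m) * Real.sqrt (Real.log n) := by
    have : 0 ≤ Real.log s := Real.log_natCast_nonneg _
    positivity
  refine hle.trans ?_
  rw [hA]
  linarith

theorem stmt9 : ∃ C : ℝ, 0 < C ∧
    ∀ (n m s : ℕ) (M : ℝ) (xs : Fin m → Fin n → ℂ), 2 ≤ n → 2 ≤ m → 2 ≤ s →
    (∀ i, ∀ a, ‖xs i a‖ ≤ M) →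
    (∫ t in Set.Ioi (0 : ℝ),
        Real.sqrt (Real.log ((coveringNumber
          {x : Fin n → ℂ | ∃ Γ : Finset (Fin n), Γ.card ≤ s ∧ (∀ i, i ∉ Γ → x i = 0) ∧
            (∑ i, ‖x i‖ ^ 2) = 1}
          (fun x y => ⨆ i : Fin m,
            ‖∑ a, (starRingEnd ℂ) (x a - y a) * xs i a‖)
          t).toNat : ℝ)))
      ≤ C * M * Real.sqrt s * Real.log s * Real.sqrt (Real.log m) * Real.sqrt (Real.log n) := by
  refine ⟨100, by norm_num, ?_⟩
  intro n m s M xs hn hm hs hxs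
  change (∫ t in Set.Ioi (0 : ℝ),
        Real.sqrt (Real.log ((coveringNumber (Tp n s) (dX xs) t).toNat : ℝ))) ≤ _
  have hM0 : 0 ≤ M := (norm_nonneg _).trans (hxs ⟨0, by omega⟩ ⟨0, by omega⟩)
  rcases hM0.eq_or_lt with h | h
  · subst h
    have : (∫ t in Set.Ioi (0 : ℝ),
        Real.sqrt (Real.log ((coveringNumber (Tp n s) (dX xs) t).toNat : ℝ))) = 0 := by
      apply MeasureTheory.setIntegral_eq_zero_of_forall_eq_zero
      intro t ht
      have ht0 : 0 < t := ht
      exact big_t xs 0 le_rfl hxs t (by simpa using ht0.le)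
    rw [this]; simp
  · exact main_bound hn hm hs xs M h hxs
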